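/- arXiv:1306.2020 — 2 statements merged into one kernel-verified Lean document; each statement's English description precedes it below -/
import Mathlib

section
/- There is a universal constant c > 0 such that for every sufficiently large integer k there exist ε > 0 and N ∈ ℕ with the following property: every tournament T on n ≥ N vertices in which the proportion t_k(T) of k-element vertex subsets inducing a transitive subtournament satisfies t_k(T) ≤ k!·2^{−binom(k,2)} + ε contains every tournament on ⌊ck⌋ vertices as an induced subtournament. -/
open Finset

/-- A tournament: an irreflexive relation such that for distinct vertices exactly one of
`r x y`, `r y x` holds. -/
def IsTournament {V : Type} (r : V → V → Prop) : Prop :=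
  (∀ x, ¬ r x x) ∧ ∀ x y : V, x ≠ y → (r x y ↔ ¬ r y x)

/-- The relation `r` restricted to `s` is transitive; for a tournament this says exactly
that `s` induces a transitive subtournament. -/
def TransOn {V : Type} (r : V → V → Prop) (s : Finset V) : Prop :=
  ∀ x ∈ s, ∀ y ∈ s, ∀ z ∈ s, r x y → r y z → r x z

-- the probability that a uniformly random `k`-element vertex subset induces a transitive
-- subtournament
open Classical in
noncomputable def transDensity {V : Type} [Fintype V] (k : ℕ) (r : V → V → Prop) : ℝ :=
  ((((univ : Finset V).powersetCard k).filter (fun s => TransOn r s)).card : ℝ) /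
    ((Fintype.card V).choose k)


open Classical in
/-- Number of transitive sequences of length `k` inside `S`. -/
noncomputable def tcnt {V : Type} (r : V → V → Prop) : ℕ → Finset V → ℕ
  | 0, _ => 1
  | k + 1, S => ∑ v ∈ S, tcnt r k (S.filter (fun w => r v w))

open Classical in
theorem tcnt_le {V : Type} (r : V → V → Prop) (hr : IsTournament r) (k : ℕ) (S : Finset V) :
    tcnt r k S ≤ ((S.powersetCard k).filter (fun s => TransOn r s)).card := by
  induction k generalizing S with
  | zero =>
    simp only [tcnt, Finset.powersetCard_zero]
    rw [Finset.filter_true_of_mem]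
    · simp
    · intro s hs
      simp only [Finset.mem_singleton] at hs
      subst hs
      intro x hx
      simp at hx
  | succ k ih =>
    simp only [tcnt]
    set F : V → Finset (Finset V) := fun v =>
      (((S.filter (fun w => r v w)).powersetCard k).filter (fun s => TransOn r s)).image
        (fun s => insert v s) with hF
    have asym : ∀ x y, r x y → ¬ r y x := by
      intro x y hxy
      have hne : x ≠ y := by
        rintro rfl
        exact hr.1 _ hxy
      exact (hr.2 x y hne).1 hxy
    have hmem : ∀ v t, t ∈ F v ↔ ∃ s, (s ⊆ S.filter (fun w => r v w) ∧ s.card = k) ∧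
        TransOn r s ∧ insert v s = t := by
      intro v t
      simp only [hF, Finset.mem_image, Finset.mem_filter, Finset.mem_powersetCard, and_assoc]
    have hcard : ∀ v ∈ S, tcnt r k (S.filter (fun w => r v w)) ≤ (F v).card := by
      intro v hv
      refine (ih _).trans ?_
      rw [hF, Finset.card_image_of_injOn]
      intro s hs s' hs' h
      have hn : ∀ s : Finset V, s ⊆ S.filter (fun w => r v w) → v ∉ s := by
        intro s hs h
        exact hr.1 v (Finset.mem_filter.1 (hs h)).2
      simp only [Finset.coe_filter, Finset.mem_powersetCard, Set.mem_ofPred_eq] at hs hs'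
      have h1 := hn s hs.1.1
      have h2 := hn s' hs'.1.1
      have := congrArg (fun z => z.erase v) h
      simpa [Finset.erase_insert h1, Finset.erase_insert h2] using this
    refine (Finset.sum_le_sum hcard).trans ?_
    rw [← Finset.card_biUnion]
    · apply Finset.card_le_card
      intro t ht
      rw [Finset.mem_biUnion] at ht
      obtain ⟨v, hv, ht⟩ := ht
      obtain ⟨s, ⟨hs, hk⟩, htr, rfl⟩ := (hmem v t).1 ht
      have hs' : ∀ x ∈ s, x ∈ S ∧ r v x := fun x hx => Finset.mem_filter.1 (hs hx)
      have hvs : v ∉ s := fun h => hr.1 v (hs' v h).2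
      rw [Finset.mem_filter, Finset.mem_powersetCard]
      refine ⟨⟨?_, ?_⟩, ?_⟩
      · intro x hx
        rcases Finset.mem_insert.1 hx with rfl | hx
        · exact hv
        · exact (hs' x hx).1
      · rw [Finset.card_insert_of_notMem hvs, hk]
      · intro x hx y hy z hz hxy hyz
        rcases Finset.mem_insert.1 hx with rfl | hx' <;>
        rcases Finset.mem_insert.1 hy with hy' | hy' <;>
        rcases Finset.mem_insert.1 hz with hz' | hz'
        · rw [hz']; rwa [hy'] at hxy
        · exact (hs' z hz').2
        · rw [hz'] at hyz; exact absurd hyz (asym _ _ hxy)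
        · exact (hs' z hz').2
        · rw [hz', ← hy']; exact hxy
        · rw [hy'] at hxy; exact absurd hxy (asym _ _ (hs' x hx').2)
        · rw [hz'] at hyz; exact absurd hyz (asym _ _ (hs' y hy').2)
        · exact htr x hx' y hy' z hz' hxy hyz
    · intro v hv w hw hvw
      rw [Function.onFun, Finset.disjoint_left]
      intro t h1 h2
      obtain ⟨s, ⟨hs, -⟩, -, rfl⟩ := (hmem v t).1 h1
      obtain ⟨s', ⟨hs', -⟩, -, he⟩ := (hmem w _).1 h2
      have a1 : v ∈ insert w s' := by rw [he]; simp
      have a2 : w ∈ insert v s := by rw [← he]; simp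
      have b1 : v ∈ s' := (Finset.mem_insert.1 a1).resolve_left hvw
      have b2 : w ∈ s := (Finset.mem_insert.1 a2).resolve_left (Ne.symm hvw)
      exact asym _ _ (Finset.mem_filter.1 (hs b2)).2 (Finset.mem_filter.1 (hs' b1)).2

theorem tangent1 (p : ℕ) (x b : ℝ) (hx : 0 ≤ x) (hb : 0 ≤ b) :
    b ^ (p+1) + (p+1) * b ^ p * (x - b) ≤ x ^ (p+1) := by
  induction p with
  | zero => simp
  | succ p ih =>
    have h1 := mul_le_mul_of_nonneg_left ih hx
    have h2 : 0 ≤ ((p:ℝ)+1) * b ^ p * (x - b)^2 := by positivity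
    push_cast
    have e : x ^ (p+1+1) = x * x^(p+1) := by ring
    rw [e]
    refine le_trans ?_ h1
    have : x * (b ^ (p + 1) + (p + 1) * b ^ p * (x - b)) - (b ^ (p + 1 + 1) + (p + 1 + 1) * b ^ (p + 1) * (x - b)) = ((p:ℝ)+1) * b ^ p * (x - b)^2 := by ring
    linarith

theorem tangent2 (p : ℕ) (x b : ℝ) (hx : 0 ≤ x) (hb : 0 ≤ b) :
    b ^ (p+2) + (p+2) * b ^ (p+1) * (x - b) + b ^ p * (x - b)^2 ≤ x ^ (p+2) := by
  have h1 := mul_le_mul_of_nonneg_left (tangent1 p x b hx hb) hx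
  have h2 : 0 ≤ (p:ℝ) * b ^ p * (x - b)^2 := by positivity
  have e : x ^ (p+2) = x * x^(p+1) := by ring
  rw [e]
  refine le_trans ?_ h1
  have : x * (b ^ (p + 1) + (p + 1) * b ^ p * (x - b)) - (b ^ (p+2) + (p+2) * b ^ (p+1) * (x - b) + b ^ p * (x - b)^2) = (p:ℝ) * b ^ p * (x - b)^2 := by ring
  linarith

open Classical in
/-- adjacency indicator -/
noncomputable def adj {V : Type} (r : V → V → Prop) (u v : V) : ℝ := if r u v then 1 else 0

open Classical in
theorem adj_add {V : Type} (r : V → V → Prop) (hr : IsTournament r) (u v : V) :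
    adj r u v + adj r v u = 1 - if u = v then 1 else 0 := by
  by_cases h : u = v
  · subst h
    simp [adj, hr.1 u]
  · have := hr.2 u v h
    by_cases h1 : r u v <;> by_cases h2 : r v u <;> simp_all [adj]

open Classical in
theorem card_filter_adj {V : Type} (r : V → V → Prop) (v : V) (S : Finset V) :
    ((S.filter (fun w => r v w)).card : ℝ) = ∑ w ∈ S, adj r v w := by
  simp [adj]

open Classical in
theorem card_filter_adj_in {V : Type} (r : V → V → Prop) (v : V) (S : Finset V) :
    ((S.filter (fun w => r w v)).card : ℝ) = ∑ w ∈ S, adj r w v := by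
  simp [adj]

theorem sum_adj {V : Type} (r : V → V → Prop) (hr : IsTournament r) (S : Finset V) :
    ∑ u ∈ S, ∑ v ∈ S, adj r u v = S.card * (S.card - 1 : ℝ) / 2 := by
  classical
  have h1 : ∑ u ∈ S, ∑ v ∈ S, adj r u v = ∑ u ∈ S, ∑ v ∈ S, adj r v u := Finset.sum_comm
  have h2 : ∑ u ∈ S, ∑ v ∈ S, (adj r u v + adj r v u) = S.card * (S.card - 1 : ℝ) := by
    simp_rw [adj_add r hr]
    simp [Finset.sum_sub_distrib]
    ring
  simp only [Finset.sum_add_distrib] at h2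
  linarith

theorem tcnt_lower {V : Type} (r : V → V → Prop) (hr : IsTournament r) (k : ℕ) (S : Finset V) :
    (max ((S.card : ℝ) - (2^k - 1)) 0) ^ k ≤ 2 ^ (k.choose 2) * (tcnt r k S : ℝ) := by
  classical
  induction k generalizing S with
  | zero => simp [tcnt]
  | succ k ih =>
    rcases Nat.eq_zero_or_pos k with hk | hk
    · subst hk
      simp only [tcnt]
      norm_num
    obtain ⟨p, rfl⟩ : ∃ p, k = p + 1 := ⟨k - 1, by omega⟩
    set a : ℝ := 2^(p+1) - 1 with ha
    have ha0 : 0 ≤ a := by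
      have : (1:ℝ) ≤ 2^(p+1) := one_le_pow₀ (by norm_num)
      linarith
    set s : ℝ := (S.card : ℝ) with hs
    have hs0 : 0 ≤ s := by positivity
    set b : ℝ := max ((s-1)/2 - a) 0 with hb
    have hb0 : 0 ≤ b := le_max_right _ _
    set x : V → ℝ := fun v => max (((S.filter (fun w => r v w)).card : ℝ) - a) 0 with hx
    have hx0 : ∀ v, 0 ≤ x v := fun v => le_max_right _ _
    have hsum : s * b ≤ ∑ v ∈ S, x v := by
      rcases le_total ((s-1)/2 - a) 0 with h | h
      · rw [hb, max_eq_right h]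
        simpa using Finset.sum_nonneg (fun v _ => hx0 v)
      · rw [hb, max_eq_left h]
        have h1 : ∑ v ∈ S, (((S.filter (fun w => r v w)).card : ℝ) - a) ≤ ∑ v ∈ S, x v :=
          Finset.sum_le_sum (fun v _ => le_max_left _ _)
        rw [Finset.sum_sub_distrib] at h1
        simp_rw [card_filter_adj] at h1
        rw [sum_adj r hr] at h1
        simp only [Finset.sum_const, nsmul_eq_mul] at h1
        refine le_trans (le_of_eq ?_) h1
        ring
    have h1 : ∑ v ∈ S, (b ^ (p+1) + (p+1) * b ^ p * (x v - b)) ≤ ∑ v ∈ S, x v ^ (p+1) :=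
      Finset.sum_le_sum (fun v _ => tangent1 p (x v) b (hx0 v) hb0)
    rw [Finset.sum_add_distrib, ← Finset.mul_sum, Finset.sum_sub_distrib] at h1
    simp only [Finset.sum_const, nsmul_eq_mul] at h1
    have h2 : 0 ≤ ((p:ℝ)+1) * b ^ p * (∑ v ∈ S, x v - s * b) :=
      mul_nonneg (by positivity) (by linarith)
    have h3 : ∑ v ∈ S, x v ^ (p+1) ≤ 2 ^ ((p+1).choose 2) *
        ∑ v ∈ S, (tcnt r (p+1) (S.filter (fun w => r v w)) : ℝ) := by
      rw [Finset.mul_sum]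
      exact Finset.sum_le_sum (fun v _ => ih _)
    have h4 : (tcnt r (p+1+1) S : ℝ) = ∑ v ∈ S, (tcnt r (p+1) (S.filter (fun w => r v w)) : ℝ) := by
      rw [tcnt]; push_cast; rfl
    have hc : (p+1+1).choose 2 = (p+1) + (p+1).choose 2 := by
      rw [Nat.choose_succ_succ' (p+1) 1]; simp
    rw [h4, hc, pow_add 2 (p+1) ((p+1).choose 2), mul_assoc]
    have h5 : s * b ^ (p+1) ≤ 2 ^ ((p+1).choose 2) *
        ∑ v ∈ S, (tcnt r (p+1) (S.filter (fun w => r v w)) : ℝ) := by linarith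
    have h6 : max (s - (2^(p+1+1) - 1)) 0 = 2 * b := by
      rw [hb, mul_max_of_nonneg _ _ (by norm_num : (0:ℝ) ≤ 2), ha]
      congr 1
      · ring
      · simp
    have h7 : 2 * b ≤ s := by
      rw [← h6]
      apply max_le _ hs0
      have : (1:ℝ) ≤ 2^(p+1+1) := one_le_pow₀ (by norm_num)
      linarith
    rw [h6]
    calc (2*b)^(p+1+1) = 2^(p+1) * ((2*b) * b^(p+1)) := by ring
      _ ≤ 2^(p+1) * (s * b^(p+1)) := by gcongr
      _ ≤ _ := by gcongr

theorem adj_nonneg {V : Type} (r : V → V → Prop) (u v : V) : 0 ≤ adj r u v := by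
  unfold adj; split_ifs <;> norm_num

theorem adj_le_one {V : Type} (r : V → V → Prop) (u v : V) : adj r u v ≤ 1 := by
  unfold adj; split_ifs <;> norm_num

theorem adj_sq {V : Type} (r : V → V → Prop) (u v : V) : adj r u v * adj r u v = adj r u v := by
  unfold adj; split_ifs <;> norm_num

theorem tri {V : Type} [Fintype V] (r : V → V → Prop) (hr : IsTournament r) :
    ∑ u : V, ∑ v : V, adj r u v * (∑ w, adj r u w * adj r v w) =
      (∑ u : V, (∑ w, adj r u w)^2 - ∑ u : V, ∑ w, adj r u w) / 2 := by
  classical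
  rw [← Finset.sum_sub_distrib, Finset.sum_div]
  refine Finset.sum_congr rfl (fun u _ => ?_)
  have h1 : ∑ v : V, adj r u v * (∑ w, adj r u w * adj r v w) =
      ∑ v : V, ∑ w : V, adj r u v * adj r u w * adj r v w := by
    simp_rw [Finset.mul_sum, mul_assoc]
  have h2 : ∑ v : V, ∑ w : V, adj r u v * adj r u w * adj r v w =
      ∑ v : V, ∑ w : V, adj r u v * adj r u w * adj r w v := by
    rw [Finset.sum_comm]
    refine Finset.sum_congr rfl (fun v _ => Finset.sum_congr rfl (fun w _ => ?_))
    ring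
  have h3 : ∑ v : V, ∑ w : V, adj r u v * adj r u w * (adj r v w + adj r w v) =
      (∑ w, adj r u w)^2 - ∑ w, adj r u w := by
    simp_rw [adj_add r hr, mul_sub, Finset.sum_sub_distrib, mul_one]
    congr 1
    · rw [sq, Finset.sum_mul_sum]
    · simp [adj_sq]
  simp_rw [mul_add, Finset.sum_add_distrib] at h3
  rw [h1]
  linarith

theorem tcnt_two {V : Type} [Fintype V] (r : V → V → Prop) (hr : IsTournament r) (p : ℕ) :
    ∑ u : V, ∑ v : V, adj r u v *
      (max ((∑ w, adj r u w * adj r v w) - ((2:ℝ)^p - 1)) 0) ^ p ≤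
    2 ^ (p.choose 2) * (tcnt r (p+2) (Finset.univ : Finset V) : ℝ) := by
  classical
  have h : (tcnt r (p+2) (Finset.univ : Finset V) : ℝ) = ∑ u : V, ∑ v : V, adj r u v *
      (tcnt r p ((Finset.univ.filter (fun w => r u w)).filter (fun w => r v w)) : ℝ) := by
    simp only [tcnt]
    push_cast
    refine Finset.sum_congr rfl (fun u _ => ?_)
    rw [Finset.sum_filter]
    refine Finset.sum_congr rfl (fun v _ => ?_)
    by_cases h : r u v <;> simp [adj, h]
  rw [h, Finset.mul_sum]
  refine Finset.sum_le_sum (fun u _ => ?_)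
  rw [Finset.mul_sum]
  refine Finset.sum_le_sum (fun v _ => ?_)
  have h1 := tcnt_lower r hr p ((Finset.univ.filter (fun w => r u w)).filter (fun w => r v w))
  have h2 : ((((Finset.univ.filter (fun w => r u w)).filter (fun w => r v w)).card : ℕ) : ℝ) =
      ∑ w, adj r u w * adj r v w := by
    rw [card_filter_adj, Finset.sum_filter]
    refine Finset.sum_congr rfl (fun w _ => ?_)
    by_cases h : r u w <;> simp [adj, h]
  rw [h2] at h1
  have := mul_le_mul_of_nonneg_left h1 (adj_nonneg r u v)
  linarith

open Classical in
theorem tcnt_upper {V : Type} [Fintype V] (r : V → V → Prop) (hr : IsTournament r) (k : ℕ)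
    (hk : k ≤ Fintype.card V) (ε : ℝ) (hε : 0 ≤ ε)
    (h : transDensity k r ≤ (k.factorial : ℝ) * (2 : ℝ) ^ (-(k.choose 2 : ℤ)) + ε) :
    2 ^ (k.choose 2) * (tcnt r k (Finset.univ : Finset V) : ℝ) ≤
      (1 + 2 ^ (k.choose 2) * ε) * (Fintype.card V : ℝ) ^ k := by
  unfold transDensity at h
  have hc : (0:ℝ) < ((Fintype.card V).choose k : ℝ) := by exact_mod_cast Nat.choose_pos hk
  rw [div_le_iff₀ hc] at h
  have h1 : (tcnt r k (Finset.univ : Finset V) : ℝ) ≤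
      ((((univ : Finset V).powersetCard k).filter (fun s => TransOn r s)).card : ℝ) := by
    exact_mod_cast tcnt_le r hr k Finset.univ
  have h2 : ((Fintype.card V).choose k : ℝ) ≤ (Fintype.card V : ℝ) ^ k / (k.factorial : ℝ) :=
    Nat.choose_le_pow_div k (Fintype.card V)
  have hf : (1:ℝ) ≤ k.factorial := by exact_mod_cast Nat.factorial_pos k
  rw [le_div_iff₀ (by linarith)] at h2
  rw [zpow_neg, zpow_natCast] at h
  set P : ℝ := 2 ^ (k.choose 2) with hP
  have hP0 : 0 < P := by positivity
  set c : ℝ := ((Fintype.card V).choose k : ℝ)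
  set F : ℝ := (k.factorial : ℝ)
  set X : ℝ := (Fintype.card V : ℝ) ^ k
  have h3 : c ≤ c * F := by nlinarith
  have h4 : P * (tcnt r k (Finset.univ : Finset V) : ℝ) ≤ P * ((F * P⁻¹ + ε) * c) := by
    gcongr
    exact h1.trans h
  refine h4.trans ?_
  have e : P * ((F * P⁻¹ + ε) * c) = c * F + P * ε * c := by
    field_simp
  rw [e, add_mul, one_mul]
  have : P * ε * c ≤ P * ε * X := by
    gcongr
    linarith
  linarith

theorem choose_aux (p : ℕ) : (p+4).choose 2 = (p+2).choose 2 + (2 * p + 5) := by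
  rw [Nat.choose_succ_succ' (p+3) 1, Nat.choose_succ_succ' (p+2) 1]
  simp
  ring

theorem stab_core {V : Type} [Fintype V] (r : V → V → Prop) (hr : IsTournament r) (p : ℕ)
    (hk : p + 4 ≤ Fintype.card V) (ε : ℝ) (hε : 0 ≤ ε)
    (h : transDensity (p+4) r ≤
      ((p+4).factorial : ℝ) * (2 : ℝ) ^ (-((p+4).choose 2 : ℤ)) + ε)
    (n : ℝ) (hn : n = Fintype.card V) (a : ℝ) (ha : a = 2^(p+2) - 1) :
    n / 4 * (∑ u : V, ((∑ w, adj r u w) - n/2)^2) +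
      ∑ u : V, ∑ v : V, adj r u v * (max ((∑ w, adj r u w * adj r v w) - a) 0 - n/4)^2 ≤
    2^((p+4).choose 2) * ε * n^4 + (1/32 + (p+2)*(1+a)/8) * n^3 := by
  have hlow := tcnt_two r hr (p+2)
  have hup := tcnt_upper r hr (p+4) hk ε hε h
  rw [← ha] at hlow
  rw [← hn] at hup
  have hn4 : 4 ≤ n := by
    rw [hn]; exact_mod_cast (by omega : 4 ≤ Fintype.card V)
  have hn0 : 0 < n := by linarith
  have ha0 : 0 ≤ a := by
    have : (1:ℝ) ≤ 2^(p+2) := one_le_pow₀ (by norm_num)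
    linarith
  set D : V → V → ℝ := fun u v => ∑ w, adj r u w * adj r v w with hD
  set d : V → ℝ := fun u => ∑ w, adj r u w with hd
  set y : V → V → ℝ := fun u v => max (D u v - a) 0 with hy
  have hy0 : ∀ u v, 0 ≤ y u v := fun u v => le_max_right _ _
  set Q : ℝ := ∑ u : V, (d u - n/2)^2 with hQ
  set R : ℝ := ∑ u : V, ∑ v : V, adj r u v * (y u v - n/4)^2 with hR
  have hQ0 : 0 ≤ Q := Finset.sum_nonneg (fun u _ => sq_nonneg _)
  set b : ℝ := n/4 with hb
  have hb0 : 0 < b := by positivity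
  have hM : ∑ u : V, ∑ v : V, adj r u v = n * (n-1)/2 := by
    rw [sum_adj r hr, Finset.card_univ, ← hn]
  set Y : ℝ := ∑ u : V, ∑ v : V, adj r u v * y u v with hY
  have htan : b^p * (b^2 * (n * (n-1)/2) + (p+2) * b * (Y - b * (n * (n-1)/2)) + R) ≤
      ∑ u : V, ∑ v : V, adj r u v * (y u v)^(p+2) := by
    have e : b^p * (b^2 * (n * (n-1)/2) + (p+2) * b * (Y - b * (n * (n-1)/2)) + R) =
        ∑ u : V, ∑ v : V, adj r u v *
          (b ^ (p+2) + (p+2) * b ^ (p+1) * (y u v - b) + b ^ p * (y u v - b)^2) := by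
      have e1 : ∀ u v, adj r u v *
          (b ^ (p+2) + (p+2) * b ^ (p+1) * (y u v - b) + b ^ p * (y u v - b)^2) =
          (b^(p+2) - (p+2) * b^(p+1) * b) * adj r u v +
          ((p+2) * b^(p+1)) * (adj r u v * y u v) + b^p * (adj r u v * (y u v - b)^2) := by
        intro u v; ring
      simp_rw [e1, Finset.sum_add_distrib, ← Finset.mul_sum]
      rw [hM, ← hY, ← hR]
      ring
    rw [e]
    refine Finset.sum_le_sum (fun u _ => Finset.sum_le_sum (fun v _ => ?_))
    exact mul_le_mul_of_nonneg_left (tangent2 p _ b (hy0 u v) hb0.le) (adj_nonneg r u v)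
  have hYlow : Q/2 - (1 + a) * n^2 / 2 ≤ Y - b * (n * (n-1)/2) := by
    have t := tri r hr
    have h1 : ∑ u : V, ∑ v : V, adj r u v * D u v - a * (n * (n-1)/2) ≤ Y := by
      rw [← hM, Finset.mul_sum, ← Finset.sum_sub_distrib]
      refine Finset.sum_le_sum (fun u _ => ?_)
      rw [Finset.mul_sum, ← Finset.sum_sub_distrib]
      refine Finset.sum_le_sum (fun v _ => ?_)
      have : adj r u v * (D u v - a) ≤ adj r u v * y u v :=
        mul_le_mul_of_nonneg_left (le_max_left _ _) (adj_nonneg r u v)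
      linarith
    have hQe : Q = ∑ u : V, (d u)^2 - n * (n * (n-1)/2) + n^3/4 := by
      have e1 : ∀ u, (d u - n/2)^2 = (d u)^2 - n * d u + n^2/4 := by intro u; ring
      rw [hQ]
      simp_rw [e1, Finset.sum_add_distrib, Finset.sum_sub_distrib, ← Finset.mul_sum]
      rw [hM]
      simp only [Finset.sum_const, nsmul_eq_mul, Finset.card_univ, ← hn]
      ring
    rw [hM] at t
    change ∑ u : V, ∑ v : V, adj r u v * D u v = (∑ u : V, (d u)^2 - n * (n-1)/2)/2 at t
    rw [t] at h1
    rw [hb]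
    nlinarith [mul_nonneg ha0 hn0.le]
  have hcomb : b^p * (b^2 * (n * (n-1)/2) + (p+2) * b * (Y - b * (n * (n-1)/2)) + R) ≤
      b^p * (n^4/32 + 2^((p+4).choose 2) * ε * n^4) := by
    have e1 : (2:ℝ)^((p+4).choose 2) = 2^((p+2).choose 2) * (32 * 4^p) := by
      rw [choose_aux, pow_add, pow_add, pow_mul]; norm_num; ring
    have h1 : 32 * 4^p * (2 ^ ((p+2).choose 2) * (tcnt r (p+4) (Finset.univ : Finset V) : ℝ)) ≤
        32 * 4^p * (b^p * (n^4/32 + 2^((p+4).choose 2) / 32 * ε * n^4)) := by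
      have e2 : 32 * 4^p * (b^p * (n^4/32 + 2^((p+4).choose 2) / 32 * ε * n^4)) =
          (1 + 2 ^ ((p+4).choose 2) * ε) * n^(p+4) := by
        have : n^(p+4) = 4^p * b^p * n^4 := by
          rw [← mul_pow, hb, mul_div_cancel₀ _ (by norm_num : (4:ℝ) ≠ 0), pow_add]
        rw [this]; ring
      rw [e2]
      refine le_trans (le_of_eq ?_) hup
      rw [e1]; ring
    have h2 := le_of_mul_le_mul_left h1 (by positivity)
    have h3 : b^p * (n^4/32 + 2^((p+4).choose 2) / 32 * ε * n^4) ≤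
        b^p * (n^4/32 + 2^((p+4).choose 2) * ε * n^4) := by
      gcongr
      have : (0:ℝ) ≤ 2^((p+4).choose 2) := by positivity
      linarith
    exact htan.trans (hlow.trans (h2.trans h3))
  have hfin := le_of_mul_le_mul_left hcomb (by positivity)
  have h1 : (p+2) * b * (Q/2 - (1 + a) * n^2 / 2) ≤ (p+2) * b * (Y - b * (n * (n-1)/2)) := by
    gcongr
  have h2 : 2 * b * (Q/2) ≤ (p+2) * b * (Q/2) := by
    gcongr
    have : (0:ℝ) ≤ p := by positivity
    linarith
  have e3 : b^2 * (n * (n-1)/2) = n^4/32 - n^3/32 := by rw [hb]; ring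
  have e4 : (p+2) * b * (Q/2 - (1 + a) * n^2 / 2) =
      (p+2) * b * (Q/2) - (p+2) * (1+a)/8 * n^3 := by rw [hb]; ring
  rw [e3] at hfin
  rw [e4] at h1
  linarith

theorem stab (p : ℕ) (τ : ℝ) (hτ : 0 < τ) : ∃ ε : ℝ, 0 < ε ∧ ∃ N : ℕ,
    ∀ (V : Type) [Fintype V] (r : V → V → Prop), IsTournament r → N ≤ Fintype.card V →
    transDensity (p+4) r ≤ ((p+4).factorial : ℝ) * (2 : ℝ) ^ (-((p+4).choose 2 : ℤ)) + ε →
    ∑ u : V, ∑ v : V, ((∑ w, adj r u w * adj r v w) - (Fintype.card V : ℝ)/4)^2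
      ≤ τ^2 * (Fintype.card V : ℝ)^4 ∧
    ∑ u : V, ((∑ w, adj r u w) - (Fintype.card V : ℝ)/2)^2 ≤ τ^2 * (Fintype.card V : ℝ)^3 := by
  obtain ⟨a, ha⟩ : ∃ a : ℝ, a = 2^(p+2) - 1 := ⟨_, rfl⟩
  have ha0 : 0 ≤ a := by
    have : (1:ℝ) ≤ 2^(p+2) := one_le_pow₀ (by norm_num)
    linarith
  obtain ⟨C, hC⟩ : ∃ C : ℝ, C = 1/32 + (p+2)*(1+a)/8 := ⟨_, rfl⟩
  obtain ⟨N1, hN1⟩ := exists_nat_ge (C / (τ^2/16))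
  obtain ⟨N2, hN2⟩ := exists_nat_ge ((2 * a^2 + 1) / (τ^2/2))
  refine ⟨τ^2/16 / 2^((p+4).choose 2), by positivity, max (p+4) (max N1 N2), ?_⟩
  intro V _ r hr hN h
  classical
  set n : ℝ := (Fintype.card V : ℝ) with hn
  have hk : p + 4 ≤ Fintype.card V := le_trans (le_max_left _ _) hN
  have hNr : N1 ≤ n ∧ N2 ≤ n := by
    rw [hn]
    constructor
    · exact_mod_cast le_trans (le_trans (le_max_left _ _) (le_max_right _ _)) hN
    · exact_mod_cast le_trans (le_trans (le_max_right _ _) (le_max_right _ _)) hN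
  have hn4 : 4 ≤ n := by
    rw [hn]; exact_mod_cast (by omega : 4 ≤ Fintype.card V)
  have hn0 : 0 < n := by linarith
  have core := stab_core r hr p hk _ (by positivity) h n hn a ha
  rw [← hC] at core
  have hCn : C * n^3 ≤ τ^2/16 * n^4 := by
    have h1 : C ≤ n * (τ^2/16) := by
      rw [← div_le_iff₀ (by positivity)]; linarith [hNr.1]
    have : C * n^3 ≤ n * (τ^2/16) * n^3 := by gcongr
    linarith
  have hAn : (2 * a^2 + 1) * n^3 ≤ τ^2/2 * n^4 := by
    have h1 : (2 * a^2 + 1) ≤ n * (τ^2/2) := by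
      rw [← div_le_iff₀ (by positivity)]; linarith [hNr.2]
    have : (2 * a^2 + 1) * n^3 ≤ n * (τ^2/2) * n^3 := by gcongr
    linarith
  rw [mul_div_cancel₀ _ (by positivity)] at core
  set D : V → V → ℝ := fun u v => ∑ w, adj r u w * adj r v w with hD
  set d : V → ℝ := fun u => ∑ w, adj r u w with hd
  set Q : ℝ := ∑ u : V, (d u - n/2)^2 with hQ
  set R : ℝ := ∑ u : V, ∑ v : V, adj r u v * (max (D u v - a) 0 - n/4)^2 with hR
  have hQ0 : 0 ≤ Q := Finset.sum_nonneg (fun u _ => sq_nonneg _)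
  have hR0 : 0 ≤ R := Finset.sum_nonneg (fun u _ => Finset.sum_nonneg (fun v _ =>
    mul_nonneg (adj_nonneg r u v) (sq_nonneg _)))
  have hRb : R ≤ τ^2/8 * n^4 := by
    have : 0 ≤ n/4 * Q := by positivity
    linarith
  have hQb : n * Q ≤ n * (τ^2 * n^3) := by
    have : 0 ≤ τ^2/2 * n^4 := by positivity
    linarith
  refine ⟨?_, le_of_mul_le_mul_left hQb hn0⟩
  have hD0 : ∀ u v, 0 ≤ D u v := fun u v => Finset.sum_nonneg (fun w _ =>
    mul_nonneg (adj_nonneg _ _ _) (adj_nonneg _ _ _))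
  have hDn : ∀ u v, D u v ≤ n := by
    intro u v
    have : D u v ≤ ∑ w : V, (1:ℝ) := Finset.sum_le_sum (fun w _ =>
      mul_le_one₀ (adj_le_one _ _ _) (adj_nonneg _ _ _) (adj_le_one _ _ _))
    simpa [← hn] using this
  have hsym : ∀ u v, D u v = D v u := by
    intro u v
    exact Finset.sum_congr rfl (fun w _ => mul_comm _ _)
  have hdec : ∑ u : V, ∑ v : V, (D u v - n/4)^2 =
      2 * ∑ u : V, ∑ v : V, adj r u v * (D u v - n/4)^2 + ∑ u : V, (D u u - n/4)^2 := by
    have e1 : ∀ u v, (D u v - n/4)^2 = adj r u v * (D u v - n/4)^2 +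
        adj r v u * (D v u - n/4)^2 + (if u = v then 1 else 0) * (D u v - n/4)^2 := by
      intro u v
      rw [hsym v u]
      have := adj_add r hr u v
      linear_combination (-(D u v - n/4)^2) * this
    have e2 : ∑ u : V, ∑ v : V, adj r v u * (D v u - n/4)^2 =
        ∑ u : V, ∑ v : V, adj r u v * (D u v - n/4)^2 := Finset.sum_comm
    have e3 : ∑ u : V, ∑ v : V, (if u = v then (1:ℝ) else 0) * (D u v - n/4)^2 =
        ∑ u : V, (D u u - n/4)^2 := by simp
    calc ∑ u : V, ∑ v : V, (D u v - n/4)^2 = ∑ u : V, ∑ v : V, (adj r u v * (D u v - n/4)^2 +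
        adj r v u * (D v u - n/4)^2 + (if u = v then 1 else 0) * (D u v - n/4)^2) :=
          Finset.sum_congr rfl (fun u _ => Finset.sum_congr rfl (fun v _ => e1 u v))
      _ = _ := by
        simp only [Finset.sum_add_distrib]
        rw [e2, e3]
        ring
  have hdiag : ∑ u : V, (D u u - n/4)^2 ≤ n^3 := by
    have : ∑ u : V, (D u u - n/4)^2 ≤ ∑ u : V, n^2 := by
      refine Finset.sum_le_sum (fun u _ => ?_)
      have h1 := hD0 u u
      have h2 := hDn u u
      apply sq_le_sq'
      · linarith
      · linarith
    simp only [Finset.sum_const, nsmul_eq_mul, Finset.card_univ, ← hn] at this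
    linarith
  have hM : ∑ u : V, ∑ v : V, adj r u v = n * (n-1)/2 := by
    rw [sum_adj r hr, Finset.card_univ, ← hn]
  have hoff : ∑ u : V, ∑ v : V, adj r u v * (D u v - n/4)^2 ≤
      2 * R + 2 * a^2 * (n * (n-1)/2) := by
    rw [← hM, hR]
    simp_rw [Finset.mul_sum]
    rw [← Finset.sum_add_distrib]
    refine Finset.sum_le_sum (fun u _ => ?_)
    rw [← Finset.sum_add_distrib]
    refine Finset.sum_le_sum (fun v _ => ?_)
    have h1 : (D u v - n/4)^2 ≤ 2 * (max (D u v - a) 0 - n/4)^2 + 2 * a^2 := by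
      have h2 : D u v - a ≤ max (D u v - a) 0 := le_max_left _ _
      have h3 : max (D u v - a) 0 ≤ D u v := max_le (by linarith) (hD0 u v)
      set z := max (D u v - a) 0
      have h4 : (D u v - z)^2 ≤ a^2 := by
        apply sq_le_sq' <;> linarith
      nlinarith [sq_nonneg ((z - n/4) - (D u v - z))]
    have := mul_le_mul_of_nonneg_left h1 (adj_nonneg r u v)
    linarith
  rw [hdec]
  have h2 : 4 * a^2 * (n * (n-1)/2) ≤ 2 * a^2 * n^3 := by
    have e : n * (n - 1) ≤ n^3 := by nlinarith [sq_nonneg n]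
    have := mul_le_mul_of_nonneg_left e (by positivity : 0 ≤ 2 * a^2)
    linarith
  linarith


theorem embed {V : Type} [Fintype V] [DecidableEq V] (r : V → V → Prop)
    (L β : ℝ) (hL : 0 < L) (M : ℕ) (hβ : M * β < L)
    (hβ0 : 0 ≤ β)
    (bad : Finset V → Finset V)
    (hcard : ∀ B : Finset V, L ≤ B.card → ((bad B).card : ℝ) ≤ β)
    (hgood : ∀ B : Finset V, L ≤ B.card → ∀ v, v ∉ bad B →
      (B.card : ℝ) / 4 ≤ ∑ w ∈ B, adj r v w ∧ (B.card : ℝ) / 4 ≤ ∑ w ∈ B, adj r w v)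
    (m : ℕ) (hm : m ≤ M) (t : Fin m → Fin m → Prop) (ht : IsTournament t)
    (W : Fin m → Finset V) (hW : ∀ i, 4 ^ m * L ≤ (W i).card) :
    ∃ f : Fin m → V, (∀ i, f i ∈ W i) ∧ ∀ i j, t i j → r (f i) (f j) := by
  classical
  induction m with
  | zero => exact ⟨fun i => i.elim0, fun i => i.elim0, fun i => i.elim0⟩
  | succ m ih =>
    have hbig : ∀ i, L ≤ (W i).card := by
      intro i
      refine le_trans ?_ (hW i)
      have : (1:ℝ) ≤ 4^(m+1) := one_le_pow₀ (by norm_num)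
      nlinarith
    set U : Finset V := Finset.univ.biUnion (fun i : Fin m => bad (W i.succ)) with hU
    have hUc : (U.card : ℝ) < (W 0).card := by
      have h1 : (U.card : ℝ) ≤ ∑ i : Fin m, ((bad (W i.succ)).card : ℝ) := by
        exact_mod_cast Finset.card_biUnion_le
      have h2 : ∑ i : Fin m, ((bad (W i.succ)).card : ℝ) ≤ ∑ i : Fin m, β :=
        Finset.sum_le_sum (fun i _ => hcard _ (hbig _))
      simp only [Finset.sum_const, Finset.card_univ, Fintype.card_fin, nsmul_eq_mul] at h2
      have h3 : (m:ℝ) * β ≤ M * β := by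
        have : (m:ℝ) ≤ M := by exact_mod_cast (by omega : m ≤ M)
        gcongr
      linarith [hbig 0]
    obtain ⟨v, hv0, hv⟩ := Finset.exists_mem_notMem_of_card_lt_card
      (by exact_mod_cast hUc : U.card < (W 0).card)
    have hvb : ∀ i : Fin m, v ∉ bad (W i.succ) := by
      intro i hi
      exact hv (Finset.mem_biUnion.2 ⟨i, Finset.mem_univ _, hi⟩)
    obtain ⟨f, hf, hfr⟩ := ih (by omega) (fun i j => t i.succ j.succ)
      ⟨fun i => ht.1 _, fun i j hij => ht.2 _ _ (fun h => hij (Fin.succ_injective _ h))⟩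
      (fun i => if t 0 i.succ then (W i.succ).filter (fun w => r v w)
        else (W i.succ).filter (fun w => r w v)) (by
        intro i
        have h := hgood _ (hbig i.succ) v (hvb i)
        have h' := hW i.succ
        rw [pow_succ] at h'
        split_ifs
        · rw [card_filter_adj]
          linarith [h.1]
        · rw [card_filter_adj_in]
          linarith [h.2])
    have hfW : ∀ i : Fin m, f i ∈ W i.succ ∧ (t 0 i.succ → r v (f i)) ∧
        (¬ t 0 i.succ → r (f i) v) := by
      intro i
      have h := hf i
      by_cases h0 : t 0 i.succ
      · simp only [h0, if_true, Finset.mem_filter] at h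
        exact ⟨h.1, fun _ => h.2, fun h' => absurd h0 h'⟩
      · simp only [h0, if_false, Finset.mem_filter] at h
        exact ⟨h.1, fun h' => absurd h' h0, fun _ => h.2⟩
    refine ⟨Fin.cons v f, ?_, ?_⟩
    · intro i
      refine Fin.cases ?_ (fun i => ?_) i
      · simpa using hv0
      · simpa using (hfW i).1
    · intro i j
      refine Fin.cases ?_ (fun i => ?_) i <;> refine Fin.cases ?_ (fun j => ?_) j
      · intro h
        exact absurd h (ht.1 _)
      · intro h
        simpa using (hfW j).2.1 h
      · intro h
        have := (ht.2 i.succ 0 (Fin.succ_ne_zero i)).1 h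
        simpa using (hfW i).2.2 this
      · intro h
        simpa using hfr i j h

theorem disc {V : Type} [Fintype V] (r : V → V → Prop)
    (τ : ℝ) (hτ : 0 < τ) (n : ℝ) (hn : n = Fintype.card V) (hn0 : 0 < n)
    (hD : ∑ u : V, ∑ v : V, ((∑ w, adj r u w * adj r v w) - n/4)^2 ≤ τ^2 * n^4)
    (hQ : ∑ u : V, ((∑ w, adj r u w) - n/2)^2 ≤ τ^2 * n^3) (B : Finset V) :
    ∑ v : V, ((∑ b ∈ B, adj r b v) - B.card / 2)^2 ≤ 2 * τ * n^3 := by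
  classical
  set s : ℝ := (B.card : ℝ) with hs
  have hsn : s ≤ n := by
    rw [hs, hn]
    exact_mod_cast Finset.card_le_univ B
  have hs0 : 0 ≤ s := by positivity
  set D : V → V → ℝ := fun u v => ∑ w, adj r u w * adj r v w with hDd
  set d : V → ℝ := fun u => ∑ w, adj r u w with hd
  have key : ∑ v : V, ((∑ b ∈ B, adj r b v) - s / 2)^2 =
      ∑ b ∈ B, ∑ c ∈ B, (D b c - n/4) + ∑ b ∈ B, s * (-(d b - n/2)) := by
    have e1 : ∑ v : V, (∑ b ∈ B, adj r b v)^2 = ∑ b ∈ B, ∑ c ∈ B, D b c := by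
      simp_rw [sq, Finset.sum_mul_sum]
      rw [Finset.sum_comm]
      refine Finset.sum_congr rfl (fun b _ => ?_)
      rw [Finset.sum_comm]
    have e2 : ∑ v : V, ∑ b ∈ B, adj r b v = ∑ b ∈ B, d b := Finset.sum_comm
    have e3 : ∀ v, ((∑ b ∈ B, adj r b v) - s / 2)^2 =
        (∑ b ∈ B, adj r b v)^2 - s * (∑ b ∈ B, adj r b v) + s^2/4 := by intro v; ring
    simp_rw [e3, Finset.sum_add_distrib, Finset.sum_sub_distrib, ← Finset.mul_sum, e1, e2,
      Finset.sum_neg_distrib, Finset.sum_sub_distrib]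
    simp only [Finset.sum_const, nsmul_eq_mul, Finset.card_univ, ← hn, ← hs]
    ring
  rw [key]
  have hτn : 0 < τ * n := by positivity
  have am : ∀ x : ℝ, x ≤ x^2 / (2 * (τ * n)) + τ * n / 2 := by
    intro x
    have : x^2 / (2 * (τ * n)) + τ * n / 2 - x = (x - τ * n)^2 / (2 * (τ * n)) := by
      field_simp
      ring
    have h2 : 0 ≤ (x - τ * n)^2 / (2 * (τ * n)) := by positivity
    linarith
  have b1 : ∑ b ∈ B, ∑ c ∈ B, (D b c - n/4) ≤ τ * n^3 := by
    calc ∑ b ∈ B, ∑ c ∈ B, (D b c - n/4)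
        ≤ ∑ b ∈ B, ∑ c ∈ B, ((D b c - n/4)^2 / (2 * (τ * n)) + τ * n / 2) := by
          gcongr with b _ c _
          exact am _
      _ ≤ ∑ b : V, ∑ c : V, ((D b c - n/4)^2 / (2 * (τ * n)) + τ * n / 2) := by
          refine (Finset.sum_le_univ_sum_of_nonneg
            (fun b => Finset.sum_nonneg (fun c _ => by positivity))).trans ?_
          refine Finset.sum_le_sum (fun b _ => ?_)
          exact Finset.sum_le_univ_sum_of_nonneg (fun c => by positivity)
      _ = (∑ b : V, ∑ c : V, (D b c - n/4)^2) / (2 * (τ * n)) + n^2 * (τ * n / 2) := by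
          simp_rw [Finset.sum_add_distrib, ← Finset.sum_div]
          simp only [Finset.sum_const, nsmul_eq_mul, Finset.card_univ, ← hn]
          ring
      _ ≤ (τ^2 * n^4) / (2 * (τ * n)) + n^2 * (τ * n / 2) := by gcongr
      _ = τ * n^3 := by field_simp; ring
  have b2 : ∑ b ∈ B, s * (-(d b - n/2)) ≤ τ * n^3 := by
    calc ∑ b ∈ B, s * (-(d b - n/2))
        ≤ ∑ b ∈ B, n * ((d b - n/2)^2 / (2 * (τ * n)) + τ * n / 2) := by
          refine Finset.sum_le_sum (fun b _ => ?_)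
          have h := am (-(d b - n/2))
          rw [neg_sq] at h
          have h0 : 0 ≤ (d b - n/2)^2 / (2 * (τ * n)) + τ * n / 2 := by positivity
          exact (mul_le_mul_of_nonneg_left h hs0).trans (mul_le_mul_of_nonneg_right hsn h0)
      _ ≤ ∑ b : V, n * ((d b - n/2)^2 / (2 * (τ * n)) + τ * n / 2) :=
          Finset.sum_le_univ_sum_of_nonneg (fun c => by positivity)
      _ = n * ((∑ b : V, (d b - n/2)^2) / (2 * (τ * n)) + n * (τ * n / 2)) := by
          simp_rw [← Finset.mul_sum, Finset.sum_add_distrib, ← Finset.sum_div]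
          simp only [Finset.sum_const, nsmul_eq_mul, Finset.card_univ, ← hn]
          ring
      _ ≤ n * ((τ^2 * n^3) / (2 * (τ * n)) + n * (τ * n / 2)) := by gcongr
      _ = τ * n^3 := by field_simp; ring
  linarith

theorem universal_of_quasi (m : ℕ) : ∃ τ : ℝ, 0 < τ ∧ ∃ N : ℕ,
    ∀ (V : Type) [Fintype V] (r : V → V → Prop), IsTournament r → N ≤ Fintype.card V →
    ∑ u : V, ∑ v : V, ((∑ w, adj r u w * adj r v w) - (Fintype.card V : ℝ)/4)^2
      ≤ τ^2 * (Fintype.card V : ℝ)^4 →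
    ∑ u : V, ((∑ w, adj r u w) - (Fintype.card V : ℝ)/2)^2 ≤ τ^2 * (Fintype.card V : ℝ)^3 →
    ∀ t : Fin m → Fin m → Prop, IsTournament t →
      ∃ f : Fin m → V, Function.Injective f ∧ ∀ i j, t i j ↔ r (f i) (f j) := by
  refine ⟨1 / (256 * 64^m * (m+1)), by positivity, 8 * 4^m, ?_⟩
  intro V _ r hr hN hD hQ t ht
  classical
  set τ : ℝ := 1 / (256 * 64^m * (m+1)) with hτ
  have hτ0 : 0 < τ := by positivity
  set n : ℝ := (Fintype.card V : ℝ) with hn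
  have hN' : 8 * 4^m ≤ n := by rw [hn]; exact_mod_cast hN
  have hn0 : 0 < n := lt_of_lt_of_le (by positivity) hN'
  set L : ℝ := n / 4^m with hL
  have hL0 : 0 < L := by positivity
  have hL8 : 8 ≤ L := by rw [hL, le_div_iff₀ (by positivity)]; exact hN'
  set bad : Finset V → Finset V := fun B => Finset.univ.filter
    (fun v => ((B.card : ℝ)/8)^2 ≤ ((∑ b ∈ B, adj r b v) - B.card / 2)^2) with hbad
  have h64 : (64:ℝ)^m = 4^m * (4^m)^2 := by
    rw [← pow_mul, mul_comm m 2, pow_mul, ← mul_pow]; norm_num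
  have hβ : (m:ℝ) * (128 * τ * n^3 / L^2) < L := by
    have e : (m:ℝ) * (128 * τ * n^3 / L^2) = L * ((m:ℝ) / (2 * (m + 1))) := by
      rw [hL, hτ, h64]
      field_simp
      ring
    rw [e]
    have : (m:ℝ) / (2 * (m + 1)) < 1 := by
      rw [div_lt_one (by positivity)]
      have : (0:ℝ) ≤ m := by positivity
      linarith
    nlinarith
  have hemb : ∃ f : Fin m → V, (∀ i, f i ∈ (Finset.univ : Finset V)) ∧
      ∀ i j, t i j → r (f i) (f j) := by
    refine embed r L (128 * τ * n^3 / L^2) hL0 m hβ (by positivity) bad ?_ ?_ m le_rfl t ht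
      (fun _ => Finset.univ) ?_
    · intro B hB
      have h := disc r τ hτ0 n hn hn0 hD hQ B
      rw [le_div_iff₀ (by positivity)]
      have h1 : ((bad B).card : ℝ) * ((B.card : ℝ)/8)^2 ≤ 2 * τ * n^3 := by
        refine le_trans ?_ h
        rw [← nsmul_eq_mul]
        refine le_trans (Finset.card_nsmul_le_sum (bad B)
          (fun v => ((∑ b ∈ B, adj r b v) - (B.card:ℝ) / 2)^2) _ ?_) ?_
        · intro v hv
          exact (Finset.mem_filter.1 hv).2
        · exact Finset.sum_le_univ_sum_of_nonneg (fun v => by positivity)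
      have h2 : L^2 ≤ (B.card:ℝ)^2 := by gcongr
      have h3 : ((bad B).card : ℝ) * L^2 ≤ ((bad B).card : ℝ) * (B.card:ℝ)^2 := by gcongr
      nlinarith
    · intro B hB v hv
      set s : ℝ := (B.card : ℝ) with hs
      have hlt : ((∑ b ∈ B, adj r b v) - s / 2)^2 < (s/8)^2 := by
        by_contra hcon
        exact hv (Finset.mem_filter.2 ⟨Finset.mem_univ _, not_lt.1 hcon⟩)
      have habs := abs_lt_of_sq_lt_sq hlt (by positivity)
      rw [abs_lt] at habs
      have hsum : s - 1 ≤ ∑ w ∈ B, adj r v w + ∑ w ∈ B, adj r w v := by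
        rw [← Finset.sum_add_distrib]
        simp_rw [adj_add r hr]
        rw [Finset.sum_sub_distrib, Finset.sum_ite_eq]
        simp only [Finset.sum_const, nsmul_eq_mul, mul_one, ← hs]
        split_ifs <;> linarith
      constructor <;> linarith [habs.1, habs.2]
    · intro _
      rw [hL, Finset.card_univ, mul_div_cancel₀ _ (by positivity)]
  obtain ⟨f, -, hf⟩ := hemb
  · have hinj : Function.Injective f := by
      intro i j hij
      by_contra hne
      have h := ht.2 i j hne
      by_cases h1 : t i j
      · have := hf i j h1
        rw [hij] at this
        exact hr.1 _ this
      · have h2 : t j i := by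
          by_contra h2
          exact h1 (h.2 h2)
        have := hf j i h2
        rw [hij] at this
        exact hr.1 _ this
    refine ⟨f, hinj, fun i j => ⟨hf i j, fun h => ?_⟩⟩
    by_contra h1
    have hne : i ≠ j := by
      rintro rfl
      exact hr.1 _ h
    have h2 : t j i := by
      by_contra h2
      exact h1 ((ht.2 i j hne).2 h2)
    exact (hr.2 _ _ (fun e => hne (hinj e))).1 h (hf j i h2)

/-- There is a universal constant `c > 0` such that, for all large `k`, every large tournament
with density of transitive `k`-subsets at most `k!·2^(-binom(k,2)) + ε` contains every
tournament on `⌊ck⌋` vertices as an induced subtournament. -/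
theorem few_transitive_subsets_universal :
    ∃ c : ℝ, 0 < c ∧ ∃ k₀ : ℕ, ∀ k : ℕ, k₀ ≤ k → ∃ ε : ℝ, 0 < ε ∧ ∃ N : ℕ,
      ∀ (V : Type) [Fintype V] (r : V → V → Prop),
        IsTournament r → N ≤ Fintype.card V →
        transDensity k r ≤ (k.factorial : ℝ) * (2 : ℝ) ^ (-(k.choose 2 : ℤ)) + ε →
        ∀ t : Fin ⌊c * (k : ℝ)⌋₊ → Fin ⌊c * (k : ℝ)⌋₊ → Prop,
          IsTournament t →
          ∃ f : Fin ⌊c * (k : ℝ)⌋₊ → V, Function.Injective f ∧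
            ∀ i j, t i j ↔ r (f i) (f j) := by
  refine ⟨1, one_pos, 4, fun k hk => ?_⟩
  obtain ⟨p, rfl⟩ : ∃ p, k = p + 4 := ⟨k - 4, by omega⟩
  obtain ⟨τ, hτ, N, hN⟩ := universal_of_quasi ⌊(1:ℝ) * ((p + 4 : ℕ) : ℝ)⌋₊
  obtain ⟨ε, hε, N', hN'⟩ := stab p τ hτ
  refine ⟨ε, hε, max N N', ?_⟩
  intro V _ r hr hV hd t ht
  obtain ⟨h1, h2⟩ := hN' V r hr (le_trans (le_max_right _ _) hV) hd
  exact hN V r hr (le_trans (le_max_left _ _) hV) h1 h2 t ht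
end

section
/- (Tyomkyn) For every ε > 0 and every M ∈ ℕ there exists a finite simple graph G on n ≥ M vertices such that p₀(G) ≤ 1/8 + ε, p₃(G) ≤ 1/8 + ε, and G contains no induced path on 5 vertices; in particular no bound of the form p₀, p₃ < 1/8 + ε can guarantee 5-universality. (Such graphs are obtained by the recursive blow-up construction starting from the pentagon C₅, where five copies of the previous graph are placed in a cycle with complete bipartite graphs joining consecutive copies.) -/
open Finset

-- `tripleDensity G i` is the probability that a uniformly random 3-element subset of the
-- vertices of `G` induces a subgraph with exactly `i` edges.
open Classical in
noncomputable def tripleDensity {V : Type} [Fintype V] (G : SimpleGraph V) (i : ℕ) : ℝ :=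
  (((univ : Finset V).powersetCard 3).filter
    (fun s => ((s ×ˢ s).filter fun q => G.Adj q.1 q.2).card = 2 * i)).card /
  ((Fintype.card V).choose 3)

namespace Tyo

open Classical in
/-- real indicator of adjacency -/
noncomputable def w {V : Type} (G : SimpleGraph V) (x y : V) : ℝ := if G.Adj x y then 1 else 0

lemma w_congr {V W : Type} {G : SimpleGraph V} {H : SimpleGraph W} {x y : V} {x' y' : W}
    (h : G.Adj x y ↔ H.Adj x' y') : w G x y = w H x' y' := by
  unfold w
  by_cases hh : G.Adj x y
  · rw [if_pos hh, if_pos (h.1 hh)]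
  · rw [if_neg hh, if_neg (fun h' => hh (h.2 h'))]

lemma w_self {V : Type} (G : SimpleGraph V) (x : V) : w G x x = 0 := by
  simp [w]

noncomputable def EE {V : Type} [Fintype V] (G : SimpleGraph V) : ℝ := ∑ x, ∑ y, w G x y

noncomputable def TT {V : Type} [Fintype V] (G : SimpleGraph V) : ℝ :=
  ∑ x, ∑ y, ∑ z, w G x y * w G y z * w G x z

/-- Blow-up step. -/
def step {V : Type} (C : SimpleGraph (Fin 5)) (G : SimpleGraph V) : SimpleGraph (Fin 5 × V) where
  Adj p q := C.Adj p.1 q.1 ∨ (p.1 = q.1 ∧ G.Adj p.2 q.2)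
  symm := ⟨by
    rintro p q (h | ⟨h, h'⟩)
    · exact Or.inl h.symm
    · exact Or.inr ⟨h.symm, h'.symm⟩⟩
  loopless := ⟨by
    rintro p (h | ⟨h, h'⟩)
    · exact C.irrefl h
    · exact G.irrefl h'⟩

lemma step_compl {V : Type} (C : SimpleGraph (Fin 5)) (G : SimpleGraph V) :
    (step C G)ᶜ = step Cᶜ Gᶜ := by
  ext ⟨a, x⟩ ⟨b, y⟩
  simp only [SimpleGraph.compl_adj, step, Prod.mk.injEq, ne_eq]
  by_cases hab : a = b
  · subst hab; simp
  · simp [hab]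

lemma w_step {V : Type} (C : SimpleGraph (Fin 5)) (G : SimpleGraph V) (a b : Fin 5) (x y : V) :
    w (step C G) (a, x) (b, y) = w C a b + (if a = b then w G x y else 0) := by
  by_cases hab : a = b
  · subst hab
    rw [w_self, if_pos rfl, zero_add]
    exact w_congr (by simp [step])
  · rw [if_neg hab, add_zero]
    exact w_congr (by simp [step, hab])

/-- Numerical hypotheses on the five vertex base graph. -/
def Base (C : SimpleGraph (Fin 5)) : Prop :=
  (∀ u : ℝ, ∑ a, ∑ b, (w C a b + (if a = b then u else 0)) = 5 * u + 10) ∧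
  (∀ u v t : ℝ, ∑ a, ∑ b, ∑ c, (w C a b + (if a = b then u else 0)) *
    (w C b c + (if b = c then v else 0)) * (w C a c + (if a = c then t else 0))
     = 5 * (u * v * t) + 10 * (u + v + t))

lemma EE_step {V : Type} [Fintype V] {C : SimpleGraph (Fin 5)} (hC : Base C) (G : SimpleGraph V) :
    EE (step C G) = 5 * EE G + 10 * (Fintype.card V : ℝ) ^ 2 := by
  have h : EE (step C G) = ∑ x : V, ∑ y : V, ∑ a, ∑ b,
      (w C a b + (if a = b then w G x y else 0)) := by
    unfold EE
    simp only [Fintype.sum_prod_type, w_step]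
    rw [Finset.sum_comm]
    refine Finset.sum_congr rfl fun x _ => ?_
    conv_rhs => rw [Finset.sum_comm]
    refine Finset.sum_congr rfl fun a _ => ?_
    rw [Finset.sum_comm]
  rw [h]
  simp only [hC.1]
  simp only [Finset.sum_add_distrib, ← Finset.mul_sum, EE]
  simp
  ring

lemma TT_step {V : Type} [Fintype V] {C : SimpleGraph (Fin 5)} (hC : Base C) (G : SimpleGraph V) :
    TT (step C G) = 5 * TT G + 30 * (EE G * (Fintype.card V : ℝ)) := by
  have h : TT (step C G) = ∑ x : V, ∑ y : V, ∑ z : V, ∑ a, ∑ b, ∑ c,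
      (w C a b + (if a = b then w G x y else 0)) *
    (w C b c + (if b = c then w G y z else 0)) * (w C a c + (if a = c then w G x z else 0)) := by
    unfold TT
    simp only [Fintype.sum_prod_type, w_step]
    rw [Finset.sum_comm]
    refine Finset.sum_congr rfl fun x _ => ?_
    have h1 : ∀ F : Fin 5 → Fin 5 → Fin 5 → V → V → ℝ,
        ∑ a, ∑ b, ∑ y, ∑ c, ∑ z, F a b c y z = ∑ y, ∑ z, ∑ a, ∑ b, ∑ c, F a b c y z := by
      intro F
      calc _ = ∑ a, ∑ y, ∑ b, ∑ z, ∑ c, F a b c y z := by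
            refine Finset.sum_congr rfl fun a _ => ?_
            rw [Finset.sum_comm]
            refine Finset.sum_congr rfl fun y _ => Finset.sum_congr rfl fun b _ => ?_
            rw [Finset.sum_comm]
        _ = ∑ y, ∑ a, ∑ z, ∑ b, ∑ c, F a b c y z := by
            rw [Finset.sum_comm]
            refine Finset.sum_congr rfl fun y _ => Finset.sum_congr rfl fun b _ => ?_
            rw [Finset.sum_comm]
        _ = _ := by
            refine Finset.sum_congr rfl fun y _ => ?_
            rw [Finset.sum_comm]
    exact h1 _
  rw [h]
  have h2 : ∑ x : V, ∑ y : V, ∑ z : V, w G x z = EE G * Fintype.card V := by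
    simp only [EE, Finset.sum_mul]
    refine Finset.sum_congr rfl fun x _ => ?_
    simp [Finset.mul_sum, Finset.sum_mul, mul_comm]
  have h3 : ∑ x : V, ∑ y : V, ∑ z : V, w G x y = EE G * Fintype.card V := by
    simp [EE, Finset.sum_mul, mul_comm, Finset.mul_sum]
  have h4 : ∑ x : V, ∑ y : V, ∑ z : V, w G y z = EE G * Fintype.card V := by
    simp [EE, Finset.sum_mul, mul_comm, Finset.mul_sum]
  simp only [hC.2]
  simp only [Finset.sum_add_distrib, ← Finset.mul_sum, h2, h3, h4]
  rw [TT]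
  ring

/-- The pentagon. -/
def C5 : SimpleGraph (Fin 5) where
  Adj a b := b = a + 1 ∨ a = b + 1
  symm := ⟨by
    rintro a b (h | h)
    · exact Or.inr h
    · exact Or.inl h⟩
  loopless := ⟨by decide⟩

lemma base_C5 : Base C5 := by
  constructor
  · intro u
    simp [Fin.sum_univ_five, w, C5]
    ring
  · intro u v t
    simp [Fin.sum_univ_five, w, C5]
    ring

lemma base_C5c : Base C5ᶜ := by
  constructor
  · intro u
    simp [Fin.sum_univ_five, w, C5]
    ring
  · intro u v t
    simp [Fin.sum_univ_five, w, C5]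
    ring

def NoP {V : Type} (G : SimpleGraph V) : Prop :=
  ∀ f : Fin 5 → V, Function.Injective f →
        ¬ (∀ i j, (SimpleGraph.pathGraph 5).Adj i j ↔ G.Adj (f i) (f j))

def ce (a b : Fin 5) : Prop := a ≠ b → (b = a + 1 ∨ a = b + 1)

def cn (a b : Fin 5) : Prop := a ≠ b → ¬ (b = a + 1 ∨ a = b + 1)

instance (a b : Fin 5) : Decidable (ce a b) := by unfold ce; infer_instance

instance (a b : Fin 5) : Decidable (cn a b) := by unfold cn; infer_instance

lemma finite_fact : ∀ a b : Fin 5, ce a b → ∀ c : Fin 5, ce b c → cn a c →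
    ∀ d : Fin 5, ce c d → cn a d → cn b d → ∀ e : Fin 5, ce d e →
    cn a e → cn b e → cn c e → (b = a ∧ c = a ∧ d = a ∧ e = a) := by
  decide +kernel

lemma noP_step {V : Type} {G : SimpleGraph V} (hG : NoP G) : NoP (step C5 G) := by
  intro f hf h
  have key : ∀ i j, (f i).1 ≠ (f j).1 → ((SimpleGraph.pathGraph 5).Adj i j ↔
      ((f j).1 = (f i).1 + 1 ∨ (f i).1 = (f j).1 + 1)) := by
    intro i j hij
    rw [h i j]
    simp [step, hij, C5]
  have hp : ∀ i j : Fin 5, (SimpleGraph.pathGraph 5).Adj i j ↔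
      (i.val + 1 = j.val ∨ j.val + 1 = i.val) := fun i j => SimpleGraph.pathGraph_adj
  have hc := finite_fact (f 0).1 (f 1).1
    (fun hh => (key 0 1 hh).1 ((hp _ _).2 (by decide)))
    (f 2).1
    (fun hh => (key 1 2 hh).1 ((hp _ _).2 (by decide)))
    (fun hh h' => absurd ((hp _ _).1 ((key 0 2 hh).2 h')) (by decide))
    (f 3).1
    (fun hh => (key 2 3 hh).1 ((hp _ _).2 (by decide)))
    (fun hh h' => absurd ((hp _ _).1 ((key 0 3 hh).2 h')) (by decide))
    (fun hh h' => absurd ((hp _ _).1 ((key 1 3 hh).2 h')) (by decide))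
    (f 4).1
    (fun hh => (key 3 4 hh).1 ((hp _ _).2 (by decide)))
    (fun hh h' => absurd ((hp _ _).1 ((key 0 4 hh).2 h')) (by decide))
    (fun hh h' => absurd ((hp _ _).1 ((key 1 4 hh).2 h')) (by decide))
    (fun hh h' => absurd ((hp _ _).1 ((key 2 4 hh).2 h')) (by decide))
  obtain ⟨h1, h2, h3, h4⟩ := hc
  have hconst : ∀ i, (f i).1 = (f 0).1 := by
    intro i
    fin_cases i
    · rfl
    · exact h1
    · exact h2
    · exact h3
    · exact h4
  apply hG (fun i => (f i).2)
  · intro i j hij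
    exact hf (Prod.ext ((hconst i).trans (hconst j).symm) hij)
  · intro i j
    rw [h i j]
    have : (f i).1 = (f j).1 := (hconst i).trans (hconst j).symm
    simp [step, this]

lemma exists_graph (k : ℕ) : ∃ (V : Type) (_ : Fintype V) (G : SimpleGraph V),
    Fintype.card V = 5 ^ k ∧ EE G ≤ (5 ^ k : ℝ) ^ 2 / 2 ∧ EE Gᶜ ≤ (5 ^ k : ℝ) ^ 2 / 2 ∧
    TT G ≤ (5 ^ k : ℝ) ^ 3 / 8 ∧ TT Gᶜ ≤ (5 ^ k : ℝ) ^ 3 / 8 ∧ NoP G := by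
  induction k with
  | zero =>
    refine ⟨Unit, inferInstance, ⊥, by simp, ?_, ?_, ?_, ?_, ?_⟩
    · simp [EE, w]
    · simp [EE, w]
    · simp [TT, w]
    · simp [TT, w]
    · intro f hf
      exact absurd (hf (Subsingleton.elim (f 0) (f 1))) (by decide)
  | succ k ih =>
    obtain ⟨V, _, G, hV, h1, h2, h3, h4, h5⟩ := ih
    have hn : (0 : ℝ) < 5 ^ k := by positivity
    have hVr : (Fintype.card V : ℝ) = 5 ^ k := by exact_mod_cast hV
    refine ⟨Fin 5 × V, inferInstance, step C5 G, ?_, ?_, ?_, ?_, ?_, noP_step h5⟩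
    · simp [hV, pow_succ, mul_comm]
    · rw [EE_step base_C5, hVr, pow_succ (5 : ℝ) k]; nlinarith
    · rw [step_compl, EE_step base_C5c, hVr, pow_succ (5 : ℝ) k]; nlinarith
    · rw [TT_step base_C5, hVr, pow_succ (5 : ℝ) k]
      have := mul_le_mul_of_nonneg_right h1 hn.le
      nlinarith
    · rw [step_compl, TT_step base_C5c, hVr, pow_succ (5 : ℝ) k]
      have := mul_le_mul_of_nonneg_right h2 hn.le
      nlinarith

lemma exists_graph' (k : ℕ) : ∃ G : SimpleGraph (Fin (5 ^ k)),
    TT G ≤ (5 ^ k : ℝ) ^ 3 / 8 ∧ TT Gᶜ ≤ (5 ^ k : ℝ) ^ 3 / 8 ∧ NoP G := by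
  obtain ⟨V, _, G, hV, -, -, h3, h4, h5⟩ := exists_graph k
  let e : Fin (5 ^ k) ≃ V := (Fintype.equivFinOfCardEq hV).symm
  have hw : ∀ x y, w (G.comap e) x y = w G (e x) (e y) := fun x y => w_congr (by simp)
  have hwc : ∀ x y, w (G.comap e)ᶜ x y = w Gᶜ (e x) (e y) := fun x y => w_congr (by simp)
  refine ⟨G.comap e, ?_, ?_, ?_⟩
  · convert h3 using 1
    simp only [TT, hw]
    rw [← Equiv.sum_comp e]
    refine Finset.sum_congr rfl fun x _ => ?_
    rw [← Equiv.sum_comp e]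
    refine Finset.sum_congr rfl fun y _ => ?_
    rw [← Equiv.sum_comp e]
  · convert h4 using 1
    simp only [TT, hwc]
    rw [← Equiv.sum_comp e]
    refine Finset.sum_congr rfl fun x _ => ?_
    rw [← Equiv.sum_comp e]
    refine Finset.sum_congr rfl fun y _ => ?_
    rw [← Equiv.sum_comp e]
  · intro f hf h
    exact h5 (e ∘ f) (e.injective.comp hf) h

open Classical in
lemma count {V : Type} [Fintype V] (G : SimpleGraph V) (S : Finset (Finset V))
    (hS : ∀ s ∈ S, s.card = 3 ∧ ∀ x ∈ s, ∀ y ∈ s, x ≠ y → G.Adj x y) :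
    6 * (S.card : ℝ) ≤ TT G := by
  let T : Finset (V × V × V) := univ.filter fun t =>
    G.Adj t.1 t.2.1 ∧ G.Adj t.2.1 t.2.2 ∧ G.Adj t.1 t.2.2
  have hT : TT G = (T.card : ℝ) := by
    simp only [T, Finset.card_filter, TT, Fintype.sum_prod_type]
    push_cast
    refine Finset.sum_congr rfl fun x _ => Finset.sum_congr rfl fun y _ =>
      Finset.sum_congr rfl fun z _ => ?_
    simp only [w]
    split_ifs <;> simp_all
  rw [hT]
  have h := Finset.card_mul_le_card_mul (s := S) (t := T) (m := 6) (n := 1)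
    (fun s t => s = {t.1, t.2.1, t.2.2}) ?_ ?_
  · have h' : ((S.card * 6 : ℕ) : ℝ) ≤ ((T.card * 1 : ℕ) : ℝ) := by exact_mod_cast h
    push_cast at h'
    linarith
  · intro s hs
    obtain ⟨h3, hadj⟩ := hS s hs
    obtain ⟨x, y, z, hxy, hxz, hyz, rfl⟩ := Finset.card_eq_three.1 h3
    have axy := hadj x (by simp) y (by simp) hxy
    have axz := hadj x (by simp) z (by simp) hxz
    have ayz := hadj y (by simp) z (by simp) hyz
    have hsub : ({(x, y, z), (x, z, y), (y, x, z), (y, z, x), (z, x, y), (z, y, x)} :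
        Finset (V × V × V)) ⊆ T.bipartiteAbove (fun (s : Finset V) t => s = {t.1, t.2.1, t.2.2}) {x, y, z} := by
      intro t ht
      simp only [Finset.mem_insert, Finset.mem_singleton] at ht
      simp only [Finset.mem_bipartiteAbove, T, Finset.mem_filter, Finset.mem_univ, true_and]
      rcases ht with rfl | rfl | rfl | rfl | rfl | rfl <;>
        refine ⟨by simp [axy, axz, ayz, axy.symm, axz.symm, ayz.symm], ?_⟩ <;>
        (ext v; simp only [Finset.mem_insert, Finset.mem_singleton]; try tauto)
    refine le_trans (le_of_eq ?_) (Finset.card_le_card hsub)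
    simp [Finset.card_insert_of_notMem, hxy, hxz, hyz, hxy.symm, hxz.symm, hyz.symm]
  · intro t ht
    refine Finset.card_le_one.2 ?_
    intro a ha b hb
    rw [Finset.mem_bipartiteBelow] at ha hb
    rw [ha.2, hb.2]

lemma density_bound {n : ℕ} (hn : 3 ≤ n) {ε N : ℝ} (hε : 0 < ε) (h : 3 + 1 / ε ≤ n)
    (hN : 6 * N ≤ (n : ℝ) ^ 3 / 8) : N / (n.choose 3 : ℕ) ≤ 1 / 8 + ε := by
  have hpos : (0 : ℝ) < (n.choose 3 : ℕ) := by exact_mod_cast Nat.choose_pos hn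
  rw [div_le_iff₀ hpos]
  obtain ⟨m, rfl⟩ := Nat.exists_eq_add_of_le' hn
  have hc : (((m + 3).choose 3 : ℕ) : ℝ) * 6 = (m + 3) * (m + 2) * (m + 1) := by
    have := Nat.add_one_mul_choose_eq (m + 2) 2
    have h2 := Nat.add_one_mul_choose_eq (m + 1) 1
    simp only [Nat.succ_eq_add_one, Nat.choose_one_right] at this h2
    norm_num [add_assoc] at this h2
    have this' : ((m : ℝ) + 3) * ((m + 2).choose 2 : ℕ) = ((m + 3).choose 3 : ℕ) * 3 := by
      exact_mod_cast this
    have h2' : ((m : ℝ) + 2) * (m + 1) = ((m + 2).choose 2 : ℕ) * 2 := by exact_mod_cast h2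
    linear_combination (-2) * this' - (m + 3) * h2'
  push_cast at h hN
  have h1 : 1 ≤ ε * m := by
    have : 1 / ε ≤ m := by linarith
    rwa [div_le_iff₀ hε, mul_comm] at this
  have hm : (0 : ℝ) ≤ m := by positivity
  have h2 : ((m : ℝ) + 3) ^ 2 ≤ (1 + 8 * ε) * ((m + 2) * (m + 1)) := by
    nlinarith [mul_le_mul_of_nonneg_right h1 hm]
  have h3 := mul_le_mul_of_nonneg_left h2 (by positivity : (0 : ℝ) ≤ (m : ℝ) + 3)
  nlinarith

end Tyo

theorem tyomkyn_construction :
    ∀ ε : ℝ, 0 < ε → ∀ M : ℕ, ∃ n : ℕ, M ≤ n ∧ ∃ G : SimpleGraph (Fin n),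
      tripleDensity G 0 ≤ 1 / 8 + ε ∧
      tripleDensity G 3 ≤ 1 / 8 + ε ∧
      ∀ f : Fin 5 → Fin n, Function.Injective f →
        ¬ (∀ i j, (SimpleGraph.pathGraph 5).Adj i j ↔ G.Adj (f i) (f j)) := by
  classical
  intro ε hε M
  obtain ⟨K, hK⟩ := exists_nat_ge (3 + 1 / ε)
  let k := M + K + 3
  have hk : k < 5 ^ k := Nat.lt_pow_self (by norm_num)
  obtain ⟨G, h3, h0, hP⟩ := Tyo.exists_graph' k
  have hn3 : 3 ≤ 5 ^ k := by omega
  have hnε : 3 + 1 / ε ≤ ((5 ^ k : ℕ) : ℝ) := hK.trans (by exact_mod_cast (by omega))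
  refine ⟨5 ^ k, by omega, G, ?_, ?_, hP⟩
  · unfold tripleDensity
    rw [Fintype.card_fin]
    refine Tyo.density_bound hn3 hε hnε ?_
    push_cast
    refine le_trans (Tyo.count Gᶜ _ ?_) h0
    intro s hs
    rw [Finset.mem_filter, Finset.mem_powersetCard] at hs
    refine ⟨hs.1.2, fun x hx y hy hxy => ?_⟩
    rw [SimpleGraph.compl_adj]
    refine ⟨hxy, fun hadj => ?_⟩
    have he := Finset.card_eq_zero.1 (hs.2.trans (by norm_num))
    have : (x, y) ∈ (∅ : Finset (Fin (5 ^ k) × Fin (5 ^ k))) := by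
      rw [← he]
      simp [hx, hy, hadj]
    simp at this
  · unfold tripleDensity
    rw [Fintype.card_fin]
    refine Tyo.density_bound hn3 hε hnε ?_
    push_cast
    refine le_trans (Tyo.count G _ ?_) h3
    intro s hs
    rw [Finset.mem_filter, Finset.mem_powersetCard] at hs
    refine ⟨hs.1.2, fun x hx y hy hxy => ?_⟩
    have hsub : ((s ×ˢ s).filter fun q => G.Adj q.1 q.2) ⊆ s.offDiag := by
      intro q hq
      rw [Finset.mem_filter, Finset.mem_product] at hq
      rw [Finset.mem_offDiag]
      exact ⟨hq.1.1, hq.1.2, hq.2.ne⟩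
    have heq := Finset.eq_of_subset_of_card_le hsub (by
      rw [Finset.offDiag_card, hs.1.2]
      refine le_trans (by norm_num) (le_of_eq hs.2.symm))
    have : (x, y) ∈ s.offDiag := Finset.mem_offDiag.2 ⟨hx, hy, hxy⟩
    rw [← heq] at this
    exact (Finset.mem_filter.1 this).2
end
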